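/- The orbit of the constant function 1 under Alspach's map consists of shifted Rademacher functions: with F : K → K defined by F(f)(ω) = min{2, 2f(2ω)} for 0 ≤ ω ≤ 1/2 and F(f)(ω) = max{0, 2f(2ω−1) − 2} for 1/2 < ω ≤ 1, and g_0 = 1_{[0,1]}, g_n = F(g_{n−1}), one has for every n ≥ 1 that g_n(ω) = 2 for ω ∈ ⋃_{j=0}^{2^{n−1}−1} [2j·2^{−n}, (2j+1)·2^{−n}] and g_n(ω) = 0 otherwise (almost everywhere); equivalently, g_n = 1 + r_n almost everywhere, where r_n(ω) = sgn(sin(2ⁿ π ω)) is the n-th Rademacher function. -/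

import Mathlib

open MeasureTheory Filter Topology Real

/-- Lebesgue measure restricted to `[0,1]`. -/
noncomputable def μ01 : Measure ℝ := volume.restrict (Set.Icc (0 : ℝ) 1)

/-- Alspach's map `F(f)(ω) = min{2, 2f(2ω)}` for `ω ≤ 1/2` and
`F(f)(ω) = max{0, 2f(2ω−1) − 2}` for `ω > 1/2`. -/
noncomputable def alspachF (f : ℝ → ℝ) (ω : ℝ) : ℝ :=
  if ω ≤ 1 / 2 then min 2 (2 * f (2 * ω)) else max 0 (2 * f (2 * ω - 1) - 2)

/-- The points where the sine of frequency `2 ^ n` vanishes are negligible. -/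
theorem ae_sin_two_pow_mul_ne_zero (n : ℕ) :
    ∀ᵐ ω ∂μ01, Real.sin (2 ^ n * π * ω) ≠ 0 := by
  have hc : {ω : ℝ | Real.sin (2 ^ n * π * ω) = 0}.Countable := by
    refine (Set.countable_range fun k : ℤ => (k : ℝ) / 2 ^ n).mono ?_
    intro ω hω
    obtain ⟨k, hk⟩ := Real.sin_eq_zero_iff.1 hω
    refine ⟨k, ?_⟩
    have h : (k : ℝ) = 2 ^ n * ω := by
      apply mul_right_cancel₀ Real.pi_ne_zero
      linarith
    simp only [h]
    field_simp
  have h0 : ∀ᵐ ω ∂volume, Real.sin (2 ^ n * π * ω) ≠ 0 := by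
    simpa [ae_iff] using hc.measure_zero volume
  exact ae_restrict_of_ae h0

theorem one_add_sign_eq_zero_or_two {x : ℝ} (hx : x ≠ 0) :
    1 + Real.sign x = 0 ∨ 1 + Real.sign x = 2 := by
  rcases lt_or_gt_of_ne hx with h | h
  · left; rw [Real.sign_of_neg h]; norm_num
  · right; rw [Real.sign_of_pos h]; norm_num

/-- Away from the zeros of the sine, the iterates of Alspach's map on the constant function `1`
are the shifted Rademacher functions. -/
theorem alspachF_iterate_one_eq_one_add_sign_sin (n : ℕ) {ω : ℝ} (hω : ω ∈ Set.Icc (0 : ℝ) 1)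
    (hs : Real.sin (2 ^ (n + 1) * π * ω) ≠ 0) :
    alspachF^[n + 1] (fun _ => 1) ω = 1 + Real.sign (Real.sin (2 ^ (n + 1) * π * ω)) := by
  induction n generalizing ω with
  | zero =>
    obtain ⟨h0, h1⟩ := hω
    have hpi := Real.pi_pos
    by_cases h : ω ≤ 1 / 2
    · have hnonneg : 0 ≤ Real.sin (2 ^ (0 + 1) * π * ω) :=
        Real.sin_nonneg_of_nonneg_of_le_pi (by positivity) (by norm_num; nlinarith)
      rw [Real.sign_of_pos (lt_of_le_of_ne hnonneg hs.symm)]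
      simp only [zero_add, Function.iterate_one, alspachF, if_pos h]
      norm_num
    · have hper : Real.sin (2 ^ (0 + 1) * π * ω) = Real.sin (2 * π * ω - 2 * π) := by
        rw [Real.sin_sub_two_pi]; norm_num
      have hnonpos : Real.sin (2 ^ (0 + 1) * π * ω) ≤ 0 := by
        rw [hper]
        exact Real.sin_nonpos_of_nonpos_of_neg_pi_le (by nlinarith) (by nlinarith)
      rw [Real.sign_of_neg (lt_of_le_of_ne hnonpos hs)]
      simp only [zero_add, Function.iterate_one, alspachF, if_neg h]
      norm_num
  | succ n ih =>
    obtain ⟨h0, h1⟩ := hω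
    rw [Function.iterate_succ_apply']
    by_cases h : ω ≤ 1 / 2
    · have e : (2 : ℝ) ^ (n + 1 + 1) * π * ω = 2 ^ (n + 1) * π * (2 * ω) := by ring
      rw [e] at hs ⊢
      rw [alspachF, if_pos h, ih ⟨by linarith, by linarith⟩ hs]
      rcases one_add_sign_eq_zero_or_two hs with h' | h' <;> rw [h'] <;> norm_num
    · have e : Real.sin ((2 : ℝ) ^ (n + 1 + 1) * π * ω) =
          Real.sin (2 ^ (n + 1) * π * (2 * ω - 1)) := by
        rw [← Real.sin_sub_nat_mul_two_pi _ (2 ^ n)]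
        congr 1
        push_cast
        ring
      rw [e] at hs ⊢
      push Not at h
      rw [alspachF, if_neg h.not_ge, ih ⟨by linarith, by linarith⟩ hs]
      rcases one_add_sign_eq_zero_or_two hs with h' | h' <;> rw [h'] <;> norm_num

/-- If `sin (π x) > 0` with `0 ≤ x ≤ 2 M`, then `x` lies in one of the first `M` intervals
`[2 j, 2 j + 1]`. -/
theorem exists_even_floor_of_sin_pi_mul_pos {x : ℝ} {M : ℕ} (h0 : 0 ≤ x) (hM : x ≤ 2 * M)
    (hs : 0 < Real.sin (π * x)) : ∃ j < M, 2 * (j : ℝ) ≤ x ∧ x ≤ 2 * j + 1 := by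
  have hpi := Real.pi_pos
  have hle := Nat.floor_le h0
  have hlt := Nat.lt_floor_add_one x
  have hne : x ≠ 2 * M := by
    rintro rfl
    have : π * (2 * (M : ℝ)) = ((2 * M : ℕ) : ℝ) * π := by push_cast; ring
    rw [this, Real.sin_nat_mul_pi] at hs
    exact lt_irrefl _ hs
  obtain ⟨j, hj | hj⟩ := Nat.even_or_odd' ⌊x⌋₊
  · rw [hj] at hle hlt
    push_cast at hle hlt
    refine ⟨j, ?_, hle, hlt.le⟩
    have : (j : ℝ) < M := by linarith [lt_of_le_of_ne hM hne]
    exact_mod_cast this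
  · rw [hj] at hle hlt
    push_cast at hle hlt
    rw [← Real.sin_sub_nat_mul_two_pi _ (j + 1)] at hs
    refine absurd hs (not_lt.2 (Real.sin_nonpos_of_nonpos_of_neg_pi_le ?_ ?_))
    · push_cast; nlinarith
    · push_cast; nlinarith

theorem sin_pi_mul_nonneg_of_mem_Icc {x : ℝ} {j : ℕ} (h0 : 2 * (j : ℝ) ≤ x)
    (h1 : x ≤ 2 * j + 1) : 0 ≤ Real.sin (π * x) := by
  have hpi := Real.pi_pos
  rw [← Real.sin_sub_nat_mul_two_pi _ j]
  exact Real.sin_nonneg_of_nonneg_of_le_pi (by nlinarith) (by nlinarith)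

/-- Away from its jumps, the shifted Rademacher function is twice the indicator of the even
dyadic intervals. -/
theorem indicator_dyadic_eq_one_add_sign_sin (n : ℕ) {ω : ℝ} (hω : ω ∈ Set.Icc (0 : ℝ) 1)
    (hs : Real.sin (2 ^ (n + 1) * π * ω) ≠ 0) :
    (⋃ j ∈ Finset.range (2 ^ n),
      Set.Icc (2 * (j : ℝ) * (2 : ℝ) ^ (-((n + 1 : ℕ) : ℤ)))
        ((2 * (j : ℝ) + 1) * (2 : ℝ) ^ (-((n + 1 : ℕ) : ℤ)))).indicator (fun _ => (2 : ℝ)) ω =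
      1 + Real.sign (Real.sin (2 ^ (n + 1) * π * ω)) := by
  have hp : (0 : ℝ) < 2 ^ (n + 1) := by positivity
  have hmem : ω ∈ (⋃ j ∈ Finset.range (2 ^ n),
      Set.Icc (2 * (j : ℝ) * (2 : ℝ) ^ (-((n + 1 : ℕ) : ℤ)))
        ((2 * (j : ℝ) + 1) * (2 : ℝ) ^ (-((n + 1 : ℕ) : ℤ)))) ↔
      ∃ j : ℕ, j < 2 ^ n ∧ 2 * (j : ℝ) ≤ 2 ^ (n + 1) * ω ∧ 2 ^ (n + 1) * ω ≤ 2 * j + 1 := by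
    simp only [Set.mem_iUnion, Finset.mem_range, Set.mem_Icc, exists_prop, zpow_neg,
      zpow_natCast, ← div_eq_mul_inv, div_le_iff₀ hp, le_div_iff₀ hp, mul_comm ω]
  have e : (2 : ℝ) ^ (n + 1) * π * ω = π * (2 ^ (n + 1) * ω) := by ring
  rw [e] at hs ⊢
  rcases lt_or_gt_of_ne hs with h | h
  · rw [Real.sign_of_neg h, Set.indicator_of_notMem, add_neg_cancel]
    rw [hmem]
    rintro ⟨j, -, h0, h1⟩
    exact h.not_ge (sin_pi_mul_nonneg_of_mem_Icc h0 h1)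
  · rw [Real.sign_of_pos h, Set.indicator_of_mem, one_add_one_eq_two]
    rw [hmem]
    refine exists_even_floor_of_sin_pi_mul_pos (mul_nonneg hp.le hω.1) ?_ h
    push_cast
    nlinarith [hω.2, pow_succ (2 : ℝ) n]

/-- The orbit of the constant function `1` under Alspach's map: for every `n ≥ 1`, the
`n`-th iterate `gₙ = Fⁿ(1)` equals (almost everywhere) `2` on
`⋃_{j<2^{n−1}} [2j·2⁻ⁿ, (2j+1)·2⁻ⁿ]` and `0` elsewhere; equivalently, `gₙ = 1 + rₙ`
almost everywhere, where `rₙ(ω) = sgn(sin(2ⁿπω))` is the `n`-th Rademacher function. -/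
theorem alspachF_orbit_of_one :
    ∀ n : ℕ, 1 ≤ n →
      (alspachF^[n] (fun _ => 1) =ᵐ[μ01]
        (⋃ j ∈ Finset.range (2 ^ (n - 1)),
          Set.Icc (2 * (j : ℝ) * (2 : ℝ) ^ (-(n : ℤ)))
            ((2 * (j : ℝ) + 1) * (2 : ℝ) ^ (-(n : ℤ)))).indicator (fun _ => 2)) ∧
      (alspachF^[n] (fun _ => 1) =ᵐ[μ01]
        fun ω => 1 + Real.sign (Real.sin (2 ^ n * π * ω))) := by
  intro n hn
  obtain ⟨m, rfl⟩ := Nat.exists_eq_add_of_le' hn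
  have hI : ∀ᵐ ω ∂μ01, ω ∈ Set.Icc (0 : ℝ) 1 := ae_restrict_mem measurableSet_Icc
  constructor
  · filter_upwards [hI, ae_sin_two_pow_mul_ne_zero (m + 1)] with ω hω hs
    exact (alspachF_iterate_one_eq_one_add_sign_sin m hω hs).trans
      (indicator_dyadic_eq_one_add_sign_sin m hω hs).symm
  · filter_upwards [hI, ae_sin_two_pow_mul_ne_zero (m + 1)] with ω hω hs
    exact alspachF_iterate_one_eq_one_add_sign_sin m hω hs
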